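/- arXiv:2102.05301 — 2 statements merged into one kernel-verified Lean document; each statement's English description precedes it below -/
import Mathlib

section
/- Let T be a spanning tree of a finite connected weighted graph G rooted at r, and let e1 and e2 be independent tree edges (Subtree(e1) and Subtree(e2) are disjoint). Let S = Subtree(e1) ∪ Subtree(e2). Then the set of crossing edges of the cut given by S is exactly the symmetric difference F_{e1} Δ F_{e2}, and hence the weight of this cut equals w(F_{e1}) + w(F_{e2}) − 2·w(F_{e1} ∩ F_{e2}). -/
open SimpleGraph

/-- The crossing edges of the cut `S`: edges of `G` with exactly one endpoint in `S`. -/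
def crossEdges {V : Type*} (G : SimpleGraph V) (S : Set V) : Set (Sym2 V) :=
  {f | f ∈ G.edgeSet ∧ ∃ x y, f = s(x, y) ∧ x ∈ S ∧ y ∉ S}

/-- The total weight of a set of edges. -/
noncomputable def wSet {V : Type*} (w : Sym2 V → ℝ) (F : Set (Sym2 V)) : ℝ :=
  ∑ᶠ f ∈ F, w f

/-- The weight of the cut `S`. -/
noncomputable def cutWeight {V : Type*} (G : SimpleGraph V) (w : Sym2 V → ℝ) (S : Set V) : ℝ :=
  wSet w (crossEdges G S)

/-- The minimum cut weight of `G`: the minimum of `cutWeight` over all `S` with `∅ ⊊ S ⊊ V`. -/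
noncomputable def minCut {V : Type*} (G : SimpleGraph V) (w : Sym2 V → ℝ) : ℝ :=
  sInf (cutWeight G w '' {S : Set V | S.Nonempty ∧ S ≠ Set.univ})

/-- `F_e`: the set of edges `{x, y}` of `G` (tree and non-tree) whose unique path in `T`
between `x` and `y` contains the tree edge `e`. -/
def Fe {V : Type*} (G T : SimpleGraph V) (e : Sym2 V) : Set (Sym2 V) :=
  {f | f ∈ G.edgeSet ∧ ∃ x y, f = s(x, y) ∧ ∃ p : T.Walk x y, p.IsPath ∧ e ∈ p.edges}

/-- `Subtree(e)`: the vertices whose unique path in `T` to the root `r` passes through the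
tree edge `e`; equivalently, the vertex set of the subtree of `T` rooted at the endpoint of
`e` farther from `r`. -/
def subtree {V : Type*} (T : SimpleGraph V) (r : V) (e : Sym2 V) : Set V :=
  {x | ∃ p : T.Walk x r, p.IsPath ∧ e ∈ p.edges}


lemma path_mem_iff {V : Type*} {T : SimpleGraph V} (hT : T.IsTree) (e : Sym2 V) (x y : V) :
    (∃ p : T.Walk x y, p.IsPath ∧ e ∈ p.edges) ↔ ¬ (T.deleteEdges {e}).Reachable x y := by
  classical
  constructor
  · rintro ⟨p, hp, he⟩ ⟨q⟩
    have hle : T.deleteEdges {e} ≤ T := SimpleGraph.deleteEdges_le _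
    have hq : (q.toPath.1.mapLe hle).IsPath := (Walk.mapLe_isPath hle).2 q.toPath.2
    have heq : p = q.toPath.1.mapLe hle := by
      have := hT.isAcyclic.path_unique ⟨p, hp⟩ ⟨_, hq⟩
      exact congrArg Subtype.val this
    rw [heq, Walk.edges_mapLe_eq_edges] at he
    have := Walk.edges_subset_edgeSet _ he
    simp [SimpleGraph.edgeSet_deleteEdges] at this
  · intro h
    obtain ⟨p⟩ := hT.connected.preconnected x y
    refine ⟨p.toPath.1, p.toPath.2, ?_⟩
    by_contra hne
    exact h ⟨p.toPath.1.toDeleteEdge e hne⟩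

lemma two_classes {V : Type*} {T : SimpleGraph V} (a b : V) {x y : V} (p : T.Walk x y)
    (hy : y = a) : (T.deleteEdges {s(a, b)}).Reachable x a ∨
      (T.deleteEdges {s(a, b)}).Reachable x b := by
  induction p with
  | nil => subst hy; exact Or.inl (Reachable.refl _)
  | @cons u v w h p ih =>
    by_cases hu : s(u, v) = s(a, b)
    · rcases Sym2.eq_iff.1 hu with ⟨rfl, rfl⟩ | ⟨rfl, rfl⟩
      · exact Or.inl (Reachable.refl _)
      · exact Or.inr (Reachable.refl _)
    · have hr : (T.deleteEdges {s(a, b)}).Reachable u v :=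
        Adj.reachable (by rw [SimpleGraph.deleteEdges_adj]; exact ⟨h, hu⟩)
      exact (ih hy).imp hr.trans hr.trans

lemma mem_Fe_iff {V : Type*} {G T : SimpleGraph V} (hT : T.IsTree) (r : V) (e : Sym2 V)
    (x y : V) : s(x, y) ∈ Fe G T e ↔
      s(x, y) ∈ G.edgeSet ∧ ¬ (x ∈ subtree T r e ↔ y ∈ subtree T r e) := by
  have key : s(x, y) ∈ Fe G T e ↔
      s(x, y) ∈ G.edgeSet ∧ ¬ (T.deleteEdges {e}).Reachable x y := by
    simp only [Fe, Set.mem_setOf_eq, path_mem_iff hT]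
    refine and_congr_right fun _ => ⟨?_, fun h => ⟨x, y, rfl, h⟩⟩
    rintro ⟨x', y', h, hr⟩
    rcases Sym2.eq_iff.1 h with ⟨rfl, rfl⟩ | ⟨rfl, rfl⟩
    · exact hr
    · exact fun h => hr h.symm
  rw [key]
  refine and_congr_right fun _ => not_congr ?_
  simp only [subtree, Set.mem_setOf_eq, path_mem_iff hT, not_iff_not]
  constructor
  · exact fun h => ⟨fun h' => h.symm.trans h', fun h' => h.trans h'⟩
  · intro h
    by_cases hx : (T.deleteEdges {e}).Reachable x r
    · exact hx.trans (h.1 hx).symm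
    have hy := fun h' => hx (h.2 h')
    induction e with
    | _ a b =>
    have H : ∀ z, (T.deleteEdges {s(a, b)}).Reachable z a ∨
        (T.deleteEdges {s(a, b)}).Reachable z b := fun z => by
      obtain ⟨p⟩ := hT.connected.preconnected z a
      exact two_classes a b p rfl
    rcases H x with h1 | h1 <;> rcases H y with h2 | h2 <;> rcases H r with h3 | h3 <;>
      first
      | exact h1.trans h2.symm
      | exact absurd (h1.trans h3.symm) hx
      | exact absurd (h2.trans h3.symm) hy

lemma mem_cross_iff {V : Type*} {G : SimpleGraph V} (S : Set V) (x y : V) :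
    s(x, y) ∈ crossEdges G S ↔ s(x, y) ∈ G.edgeSet ∧ ¬ (x ∈ S ↔ y ∈ S) := by
  simp only [crossEdges, Set.mem_setOf_eq]
  refine and_congr_right fun _ => ⟨?_, fun h => ?_⟩
  · rintro ⟨x', y', h, hx, hy⟩
    rcases Sym2.eq_iff.1 h with ⟨rfl, rfl⟩ | ⟨rfl, rfl⟩ <;> tauto
  · by_cases hx : x ∈ S
    · exact ⟨x, y, rfl, hx, by tauto⟩
    · exact ⟨y, x, Sym2.eq_swap, by tauto, hx⟩

theorem stmt2 {V : Type*} [Fintype V] (G T : SimpleGraph V) (w : Sym2 V → ℝ)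
    (hw : ∀ f, 0 ≤ w f) (hG : G.Connected) (hTG : T ≤ G) (hT : T.IsTree)
    (r : V) (e1 e2 : Sym2 V) (he1 : e1 ∈ T.edgeSet) (he2 : e2 ∈ T.edgeSet)
    (hindep : Disjoint (subtree T r e1) (subtree T r e2)) :
    crossEdges G (subtree T r e1 ∪ subtree T r e2) = symmDiff (Fe G T e1) (Fe G T e2) ∧
    cutWeight G w (subtree T r e1 ∪ subtree T r e2) =
      wSet w (Fe G T e1) + wSet w (Fe G T e2) - 2 * wSet w (Fe G T e1 ∩ Fe G T e2) := by
  have hc : crossEdges G (subtree T r e1 ∪ subtree T r e2) =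
      symmDiff (Fe G T e1) (Fe G T e2) := by
    ext f
    induction f with
    | _ x y =>
    rw [Set.mem_symmDiff, mem_cross_iff, mem_Fe_iff hT r, mem_Fe_iff hT r, Set.mem_union,
      Set.mem_union]
    have hx : x ∈ subtree T r e1 → x ∉ subtree T r e2 :=
      fun h => Set.disjoint_left.1 hindep h
    have hy : y ∈ subtree T r e1 → y ∉ subtree T r e2 :=
      fun h => Set.disjoint_left.1 hindep h
    tauto
  refine ⟨hc, ?_⟩
  rw [cutWeight, hc]
  unfold wSet
  have fin : ∀ s : Set (Sym2 V), s.Finite := fun s => s.toFinite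
  have h1 := finsum_mem_inter_add_sdiff' (f := w) (s := Fe G T e1) (Fe G T e2) ((fin (Fe G T e1)).inter_of_left _)
  have h2 := finsum_mem_inter_add_sdiff' (f := w) (s := Fe G T e2) (Fe G T e1) ((fin (Fe G T e2)).inter_of_left _)
  have h3 := finsum_mem_union (f := w) (s := Fe G T e1 \ Fe G T e2) (t := Fe G T e2 \ Fe G T e1)
    disjoint_sdiff_sdiff (fin _) (fin _)
  rw [Set.inter_comm] at h2
  rw [Set.symmDiff_def, h3]
  linarith
end

section
/- Let T be a spanning tree of a finite connected weighted graph G rooted at r. For every pair of distinct tree edges e ≠ e', there exists a cut of G whose set of crossing edges is exactly F_e Δ F_{e'}. Consequently, for every pair of distinct tree edges, the quantity w(F_e) + w(F_{e'}) − 2·w(F_e ∩ F_{e'}) is at least the minimum cut weight of G. -/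
open SimpleGraph

theorem mem_crossEdges_iff {V : Type*} (G : SimpleGraph V) (S : Set V) (x y : V) :
    s(x, y) ∈ crossEdges G S ↔ G.Adj x y ∧ ¬ (x ∈ S ↔ y ∈ S) := by
  constructor
  · rintro ⟨h, u, v, huv, hu, hv⟩
    refine ⟨h, ?_⟩
    rcases Sym2.eq_iff.1 huv with ⟨rfl, rfl⟩ | ⟨rfl, rfl⟩ <;> tauto
  · rintro ⟨h, hxy⟩
    refine ⟨h, ?_⟩
    by_cases hx : x ∈ S
    · exact ⟨x, y, rfl, hx, by tauto⟩
    · exact ⟨y, x, Sym2.eq_swap, by tauto, hx⟩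

theorem crossEdges_symmDiff {V : Type*} (G : SimpleGraph V) (S S' : Set V) :
    crossEdges G (symmDiff S S') = symmDiff (crossEdges G S) (crossEdges G S') := by
  ext f
  induction f using Sym2.ind with
  | _ x y =>
    simp only [Set.mem_symmDiff, mem_crossEdges_iff]
    tauto

theorem exists_side {V : Type*} (G T : SimpleGraph V) (hT : T.IsTree) (e : Sym2 V)
    (he : e ∈ T.edgeSet) :
    ∃ S : Set V, (∀ u v, T.Adj u v → (s(u, v) = e ↔ ¬ (u ∈ S ↔ v ∈ S))) ∧
      Fe G T e = crossEdges G S := by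
  induction e using Sym2.ind with
  | _ a b =>
    have hbr : ¬ (T.deleteEdges {s(a, b)}).Reachable a b :=
      isBridge_iff.1 (isAcyclic_iff_forall_edge_isBridge.1 hT.isAcyclic he)
    have hstep : ∀ u v, T.Adj u v → s(u, v) ≠ s(a, b) →
        (T.deleteEdges {s(a, b)}).Reachable u v := fun u v h hne =>
      Adj.reachable (by rw [deleteEdges_adj]; exact ⟨h, by simpa using hne⟩)
    have hcov : ∀ x, (T.deleteEdges {s(a, b)}).Reachable a x ∨
        (T.deleteEdges {s(a, b)}).Reachable b x := by
      intro x
      have key : ∀ u v (p : T.Walk u v), ((T.deleteEdges {s(a, b)}).Reachable a v ∨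
        (T.deleteEdges {s(a, b)}).Reachable b v) → ((T.deleteEdges {s(a, b)}).Reachable a u ∨
        (T.deleteEdges {s(a, b)}).Reachable b u) := by
        intro u v p
        induction p with
        | nil => exact id
        | @cons u v z h p ih =>
          intro hz
          by_cases hne : s(u, v) = s(a, b)
          · rcases Sym2.eq_iff.1 hne with ⟨rfl, rfl⟩ | ⟨rfl, rfl⟩
            · exact Or.inl (Reachable.refl _)
            · exact Or.inr (Reachable.refl _)
          · have := (hstep u v h hne).symm
            exact (ih hz).imp (fun q => q.trans this) (fun q => q.trans this)
      obtain ⟨p⟩ := hT.connected.preconnected x a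
      exact key x a p (Or.inl (Reachable.refl _))
    have hpath : ∀ x y (p : T.Walk x y), p.IsPath → (s(a, b) ∈ p.edges ↔
        ¬ (T.deleteEdges {s(a, b)}).Reachable x y) := by
      classical
      intro x y p hp
      constructor
      · rintro hmem ⟨q⟩
        have hle : T.deleteEdges {s(a, b)} ≤ T := deleteEdges_le _
        have hq : (q.toPath.1.mapLe hle).IsPath := q.toPath.2.mapLe hle
        have := hT.isAcyclic.path_unique ⟨p, hp⟩ ⟨_, hq⟩
        have h2 : p = q.toPath.1.mapLe hle := congrArg Subtype.val this
        rw [h2, Walk.edges_mapLe_eq_edges] at hmem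
        have := Walk.edges_subset_edgeSet _ hmem
        simp at this
      · intro h
        by_contra hmem
        exact h ⟨p.toDeleteEdge _ hmem⟩
    have hside : ∀ x y, ¬ (T.deleteEdges {s(a, b)}).Reachable x y ↔
        ¬ ((T.deleteEdges {s(a, b)}).Reachable a x ↔ (T.deleteEdges {s(a, b)}).Reachable a y) := by
      intro x y
      rw [not_iff_not]
      constructor
      · exact fun h => ⟨fun q => q.trans h, fun q => q.trans h.symm⟩
      · intro h
        by_cases hx : (T.deleteEdges {s(a, b)}).Reachable a x
        · exact hx.symm.trans (h.1 hx)
        · exact ((hcov x).resolve_left hx).symm.trans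
            ((hcov y).resolve_left (fun q => hx (h.2 q)))
    refine ⟨{x | (T.deleteEdges {s(a, b)}).Reachable a x}, ?_, ?_⟩
    · intro u v h
      simp only [Set.mem_ofPred_eq]
      rw [← hside]
      constructor
      · intro heq
        rcases Sym2.eq_iff.1 heq with ⟨rfl, rfl⟩ | ⟨rfl, rfl⟩
        · exact hbr
        · exact fun q => hbr q.symm
      · intro hn
        by_contra hne
        exact hn (hstep u v h hne)
    · ext f
      induction f using Sym2.ind with
      | _ x y =>
        rw [mem_crossEdges_iff]
        simp only [Set.mem_ofPred_eq]
        rw [← hside]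
        constructor
        · rintro ⟨h, u, v, huv, p, hp, hmem⟩
          refine ⟨h, ?_⟩
          have := (hpath u v p hp).1 hmem
          rcases Sym2.eq_iff.1 huv with ⟨rfl, rfl⟩ | ⟨rfl, rfl⟩
          · exact this
          · exact fun q => this q.symm
        · rintro ⟨h, hn⟩
          obtain ⟨p, hp⟩ := (hT.connected.preconnected x y).exists_isPath
          exact ⟨h, x, y, rfl, p, hp, (hpath x y p hp).2 hn⟩

theorem wSet_symmDiff {V : Type*} [Fintype V] (w : Sym2 V → ℝ) (A B : Set (Sym2 V)) :
    wSet w (symmDiff A B) = wSet w A + wSet w B - 2 * wSet w (A ∩ B) := by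
  have h1 := finsum_mem_inter_add_sdiff (f := w) (s := A) B (Set.toFinite A)
  have h2 := finsum_mem_inter_add_sdiff (f := w) (s := B) A (Set.toFinite B)
  have h3 := finsum_mem_union (f := w) (s := A \ B) (t := B \ A)
    disjoint_sdiff_sdiff (Set.toFinite _) (Set.toFinite _)
  rw [Set.inter_comm B A] at h2
  have h4 : symmDiff A B = A \ B ∪ B \ A := rfl
  unfold wSet
  rw [h4, h3]
  linarith

theorem stmt3 {V : Type*} [Fintype V] (G T : SimpleGraph V) (w : Sym2 V → ℝ)
    (hw : ∀ f, 0 ≤ w f) (hG : G.Connected) (hTG : T ≤ G) (hT : T.IsTree) (r : V) :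
    ∀ e ∈ T.edgeSet, ∀ e' ∈ T.edgeSet, e ≠ e' →
      (∃ S : Set V, S.Nonempty ∧ S ≠ Set.univ ∧
        crossEdges G S = symmDiff (Fe G T e) (Fe G T e')) ∧
      minCut G w ≤ wSet w (Fe G T e) + wSet w (Fe G T e') -
        2 * wSet w (Fe G T e ∩ Fe G T e') := by
  intro e he e' he' hne
  have main : ∃ S : Set V, S.Nonempty ∧ S ≠ Set.univ ∧
        crossEdges G S = symmDiff (Fe G T e) (Fe G T e') := by
    obtain ⟨S, hS, hF⟩ := exists_side G T hT e he
    obtain ⟨S', hS', hF'⟩ := exists_side G T hT e' he'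
    have hc := crossEdges_symmDiff G S S'
    have hmem : e ∈ crossEdges G (symmDiff S S') := by
      induction e using Sym2.ind with
      | _ a b =>
        rw [mem_crossEdges_iff]
        refine ⟨hTG he, ?_⟩
        have h1 := (hS a b he).1 rfl
        have h2 := mt (hS' a b he).2 hne
        simp only [Set.mem_symmDiff]
        tauto
    obtain ⟨_, x, y, _, hx, hy⟩ := hmem
    refine ⟨symmDiff S S', ⟨x, hx⟩, ?_, by rw [hc, hF, hF']⟩
    intro h
    exact hy (h ▸ Set.mem_univ y)
  refine ⟨main, ?_⟩
  obtain ⟨S, h1, h2, h3⟩ := main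
  rw [← wSet_symmDiff, ← h3]
  refine csInf_le ⟨0, ?_⟩ ⟨S, ⟨h1, h2⟩, rfl⟩
  rintro _ ⟨S, -, rfl⟩
  exact finsum_nonneg fun f => finsum_nonneg fun _ => hw f
end
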